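/- arXiv:2503.05104 — 2 statements merged into one kernel-verified Lean document; each statement's English description precedes it below -/
import Mathlib

section
/- (Weight estimate for the exponential integrator.) Let 0 < α < 1, λ ≥ 0, τ > 0, and set t_k = kτ. For integers 0 ≤ j < n define the weight W_{n,j} = (t_n−t_j)^α E_{α,α+1}(−λ (t_n−t_j)^α) − (t_n−t_{j+1})^α E_{α,α+1}(−λ (t_n−t_{j+1})^α). Then there exists a constant C′ > 0, depending only on α, such that for every n ≥ 1 and every 1 ≤ j ≤ n−1, |W_{n,j}| ≤ C′ τ^α (n−j)^{α−1}. -/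
/-- The (real) Mittag-Leffler function `E_{α,β}(x) = Σ_{k} x^k / Γ(αk+β)`. -/
noncomputable def mlE (α β x : ℝ) : ℝ :=
  ∑' k : ℕ, x ^ k / Real.Gamma (α * k + β)

/-- The exponential integrator weight
`W_{n,j} = (t_n−t_j)^α E_{α,α+1}(−λ(t_n−t_j)^α)
          − (t_n−t_{j+1})^α E_{α,α+1}(−λ(t_n−t_{j+1})^α)` with `t_k = kτ`. -/
noncomputable def eiWeight (α lam τ : ℝ) (n j : ℕ) : ℝ :=
  ((n : ℝ) * τ - j * τ) ^ α * mlE α (α + 1) (-lam * ((n : ℝ) * τ - j * τ) ^ α)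
    - ((n : ℝ) * τ - (j + 1) * τ) ^ α
        * mlE α (α + 1) (-lam * ((n : ℝ) * τ - (j + 1) * τ) ^ α)

open MeasureTheory Set Filter Topology

/-- The Beta integral over `[0, t]`, in real form. -/
theorem integral_sub_rpow_mul_rpow {p q t : ℝ} (hp : 0 < p) (hq : 0 < q) (ht : 0 < t) :
    ∫ s in (0 : ℝ)..t, (t - s) ^ (q - 1) * s ^ (p - 1) =
      t ^ (p + q - 1) * (Real.Gamma p * Real.Gamma q / Real.Gamma (p + q)) := by
  have h := Complex.betaIntegral_scaled (p : ℂ) (q : ℂ) ht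
  rw [Complex.betaIntegral_eq_Gamma_mul_div _ _ (by simpa) (by simpa), ← Complex.ofReal_add,
    Complex.Gamma_ofReal, Complex.Gamma_ofReal, Complex.Gamma_ofReal] at h
  have hcongr : ∫ x in (0 : ℝ)..t, (x : ℂ) ^ ((p : ℂ) - 1) * ((t : ℂ) - x) ^ ((q : ℂ) - 1) =
      ((∫ s in (0 : ℝ)..t, (t - s) ^ (q - 1) * s ^ (p - 1) : ℝ) : ℂ) := by
    rw [← intervalIntegral.integral_ofReal]
    refine intervalIntegral.integral_congr fun x hx => ?_
    rw [uIcc_of_le ht.le] at hx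
    simp only [Complex.ofReal_mul]
    rw [Complex.ofReal_cpow hx.1, Complex.ofReal_cpow (sub_nonneg.2 hx.2)]
    push_cast
    ring
  have hpow : (t : ℂ) ^ (((p + q : ℝ) : ℂ) - 1) = ((t ^ (p + q - 1) : ℝ) : ℂ) := by
    rw [Complex.ofReal_cpow ht.le]
    push_cast
    rfl
  rw [hcongr, hpow] at h
  exact_mod_cast h

theorem intervalIntegrable_sub_rpow_mul_rpow {p q t : ℝ} (hp : 0 < p) (hq : 0 < q) (ht : 0 < t) :
    IntervalIntegrable (fun s => (t - s) ^ (q - 1) * s ^ (p - 1)) volume 0 t := by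
  refine intervalIntegral.intervalIntegrable_of_integral_ne_zero ?_
  rw [integral_sub_rpow_mul_rpow hp hq ht]
  have := Real.Gamma_pos_of_pos hp
  have := Real.Gamma_pos_of_pos hq
  have := Real.Gamma_pos_of_pos (add_pos hp hq)
  positivity

theorem rpow_mul_exp_le_Gamma {R s : ℝ} (hR : 0 < R) (hs : 1 ≤ s) :
    R ^ (s - 1) * Real.exp (-(R + 1)) ≤ Real.Gamma s := by
  have hint := Real.GammaIntegral_convergent (zero_lt_one.trans_le hs)
  have hsub : Ioc R (R + 1) ⊆ Ioi 0 := fun x hx => hR.trans hx.1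
  rw [Real.Gamma_eq_integral (zero_lt_one.trans_le hs)]
  calc R ^ (s - 1) * Real.exp (-(R + 1))
      = ∫ _ in Ioc R (R + 1), R ^ (s - 1) * Real.exp (-(R + 1)) := by simp
    _ ≤ ∫ x in Ioc R (R + 1), Real.exp (-x) * x ^ (s - 1) := by
      refine setIntegral_mono_on (integrableOn_const (by simp)) (hint.mono_set hsub) measurableSet_Ioc
        fun x hx => ?_
      rw [mul_comm]
      have := hx.1
      have := hx.2
      gcongr
    _ ≤ ∫ x in Ioi 0, Real.exp (-x) * x ^ (s - 1) := by
      refine setIntegral_mono_set hint ?_ hsub.eventuallyLE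
      filter_upwards [ae_restrict_mem measurableSet_Ioi] with x hx
      have : 0 < x := hx
      simp only [Pi.zero_apply]
      positivity

theorem summable_mlE {α β : ℝ} (hα : 0 < α) (x : ℝ) :
    Summable fun k : ℕ => x ^ k / Real.Gamma (α * k + β) := by
  set R : ℝ := (2 * |x| + 1) ^ α⁻¹ with hRdef
  have hR : 0 < R := by positivity
  have hRα : R ^ α = 2 * |x| + 1 := Real.rpow_inv_rpow (by positivity) hα.ne'
  set C : ℝ := R ^ (1 - β) * Real.exp (R + 1)
  have hgeom : Summable fun k : ℕ => C * (1 / 2 : ℝ) ^ k :=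
    (summable_geometric_of_lt_one (by norm_num) (by norm_num)).mul_left C
  refine hgeom.of_norm_bounded_eventually_nat ?_
  have hlim : Tendsto (fun k : ℕ => α * (k : ℝ) + β) atTop atTop :=
    tendsto_atTop_add_const_right _ _ (tendsto_natCast_atTop_atTop.const_mul_atTop hα)
  filter_upwards [hlim.eventually_ge_atTop 1] with k hk
  have hΓ := Real.Gamma_pos_of_pos (zero_lt_one.trans_le hk)
  rw [norm_div, norm_pow, Real.norm_eq_abs, Real.norm_of_nonneg hΓ.le, div_le_iff₀ hΓ]
  have hRpow : R ^ (α * k + β - 1) = (2 * |x| + 1) ^ k * R ^ (β - 1) := by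
    rw [← hRα, ← Real.rpow_mul_natCast hR.le, ← Real.rpow_add hR]
    ring_nf
  have hprod : R ^ (1 - β) * R ^ (β - 1) = 1 := by
    rw [← Real.rpow_add hR]; simp
  have hexp : Real.exp (R + 1) * Real.exp (-(R + 1)) = 1 := by
    rw [← Real.exp_add]; simp
  calc |x| ^ k ≤ ((1 / 2) * (2 * |x| + 1)) ^ k := by gcongr; linarith
    _ = (1 / 2) ^ k * (2 * |x| + 1) ^ k * (R ^ (1 - β) * R ^ (β - 1)) *
          (Real.exp (R + 1) * Real.exp (-(R + 1))) := by rw [hprod, hexp, mul_pow]; ring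
    _ = C * (1 / 2) ^ k * (R ^ (α * k + β - 1) * Real.exp (-(R + 1))) := by
      rw [hRpow]; ring
    _ ≤ C * (1 / 2) ^ k * Real.Gamma (α * k + β) := by
      gcongr
      exact rpow_mul_exp_le_Gamma hR hk

theorem continuous_mlE {α β : ℝ} (hα : 0 < α) : Continuous (mlE α β) := by
  rw [continuous_iff_continuousAt]
  intro x
  have hball : ContinuousOn (mlE α β) (Metric.closedBall 0 (|x| + 1)) := by
    refine continuousOn_tsum (fun k => by fun_prop) (summable_mlE (β := β) hα (|x| + 1)).norm
      fun k y hy => ?_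
    rw [norm_div, norm_div, norm_pow, norm_pow, Real.norm_of_nonneg (by positivity : 0 ≤ |x| + 1)]
    gcongr
    simpa using hy
  refine hball.continuousAt (Metric.closedBall_mem_nhds_of_mem ?_)
  simp

theorem mlE_eq_add_mul {α β : ℝ} (hα : 0 < α) (x : ℝ) :
    mlE α β x = 1 / Real.Gamma β + x * mlE α (α + β) x := by
  rw [mlE, (summable_mlE hα x).tsum_eq_zero_add, mlE, ← tsum_mul_left]
  congr 1
  · simp
  · refine tsum_congr fun k => ?_
    rw [pow_succ']
    push_cast
    rw [mul_div_assoc]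
    ring_nf

/-- The resolvent `t ^ (α - 1) * E_{α,α}(-λ t ^ α)` of the kernel `λ t ^ (α - 1) / Γ(α)`. -/
noncomputable def mlResolvent (α lam t : ℝ) : ℝ :=
  t ^ (α - 1) * mlE α α (-lam * t ^ α)

theorem integral_sub_rpow_mul_mlResolvent {α β lam t : ℝ} (hα : 0 < α) (hβ : 0 < β)
    (ht : 0 < t) :
    ∫ s in (0 : ℝ)..t, (t - s) ^ (β - 1) * mlResolvent α lam s =
      Real.Gamma β * t ^ (α + β - 1) * mlE α (α + β) (-lam * t ^ α) := by
  set F : ℕ → ℝ → ℝ := fun k s =>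
    (-lam) ^ k / Real.Gamma (α * k + α) * ((t - s) ^ (β - 1) * s ^ ((α * k + α) - 1)) with hF
  have hpos : ∀ k : ℕ, 0 < α * k + α := fun k => by positivity
  have hint : ∀ k, IntervalIntegrable (F k) volume 0 t := fun k =>
    (intervalIntegrable_sub_rpow_mul_rpow (hpos k) hβ ht).const_mul _
  have hval : ∀ k : ℕ, ∀ c : ℝ, c ^ k / Real.Gamma (α * k + α) *
      (∫ s in (0 : ℝ)..t, (t - s) ^ (β - 1) * s ^ ((α * k + α) - 1)) =
      Real.Gamma β * t ^ (α + β - 1) * ((c * t ^ α) ^ k / Real.Gamma (α * k + (α + β))) := by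
    intro k c
    rw [integral_sub_rpow_mul_rpow (hpos k) hβ ht]
    have h1 : t ^ (α * k + α + β - 1) = t ^ (α + β - 1) * (t ^ α) ^ k := by
      rw [← Real.rpow_mul_natCast ht.le, ← Real.rpow_add ht]
      ring_nf
    have := (Real.Gamma_pos_of_pos (hpos k)).ne'
    rw [h1, mul_pow, ← add_assoc]
    field_simp
  have hnorm : ∀ k : ℕ, ∫ s in Ioc 0 t, ‖F k s‖ =
      Real.Gamma β * t ^ (α + β - 1) * ((|lam| * t ^ α) ^ k / Real.Gamma (α * k + (α + β))) := by
    intro k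
    rw [← hval k, ← intervalIntegral.integral_const_mul, intervalIntegral.integral_of_le ht.le]
    refine setIntegral_congr_fun measurableSet_Ioc fun s hs => ?_
    have h1 : 0 ≤ t - s := sub_nonneg.2 hs.2
    have h2 : 0 ≤ s := hs.1.le
    have h3 := Real.Gamma_pos_of_pos (hpos k)
    simp only [hF, norm_mul, norm_div, norm_pow, norm_neg, Real.norm_eq_abs]
    rw [abs_of_pos h3, abs_of_nonneg (Real.rpow_nonneg h1 _),
      abs_of_nonneg (Real.rpow_nonneg h2 _)]
  have hsum := hasSum_integral_of_summable_integral_norm (μ := volume.restrict (Ioc 0 t))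
    (F := F) (fun k => (intervalIntegrable_iff_integrableOn_Ioc_of_le ht.le).1 (hint k))
    (by simp_rw [hnorm]; exact (summable_mlE hα _).mul_left _)
  have htsum : ∫ s in Ioc 0 t, ∑' k, F k s =
      ∫ s in (0 : ℝ)..t, (t - s) ^ (β - 1) * mlResolvent α lam s := by
    rw [intervalIntegral.integral_of_le ht.le]
    refine setIntegral_congr_fun measurableSet_Ioc fun s hs => ?_
    simp only [mlResolvent, mlE]
    rw [← mul_assoc, ← tsum_mul_left]
    refine tsum_congr fun k => ?_
    have h1 : s ^ (α * k + α - 1) = s ^ (α - 1) * (s ^ α) ^ k := by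
      rw [← Real.rpow_mul_natCast hs.1.le, ← Real.rpow_add hs.1]
      ring_nf
    simp only [hF]
    rw [h1, mul_pow]
    ring
  rw [← htsum, ← hsum.tsum_eq, mlE, ← tsum_mul_left]
  refine tsum_congr fun k => ?_
  rw [← hval k, ← intervalIntegral.integral_const_mul, intervalIntegral.integral_of_le ht.le]

theorem intervalIntegrable_sub_rpow_mul_mlResolvent {α β lam t : ℝ} (hα : 0 < α) (hβ : 0 < β)
    (ht : 0 < t) :
    IntervalIntegrable (fun s => (t - s) ^ (β - 1) * mlResolvent α lam s) volume 0 t := by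
  simp only [mlResolvent, ← mul_assoc]
  refine (intervalIntegrable_sub_rpow_mul_rpow hα hβ ht).mul_continuousOn ?_
  exact ((continuous_mlE hα).comp
    (continuous_const.mul (Real.continuous_rpow_const hα.le))).continuousOn

theorem continuousOn_mlResolvent {α lam : ℝ} (hα : 0 < α) :
    ContinuousOn (mlResolvent α lam) (Ioi 0) := by
  refine ContinuousOn.mul (fun x hx => ?_) ?_
  · exact (Real.continuousAt_rpow_const _ _ (Or.inl (ne_of_gt hx))).continuousWithinAt
  · exact ((continuous_mlE hα).comp
      (continuous_const.mul (Real.continuous_rpow_const hα.le))).continuousOn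

/-- The Volterra equation satisfied by `mlResolvent`. -/
theorem Gamma_mul_mlResolvent {α lam t : ℝ} (hα : 0 < α) (ht : 0 < t) :
    Real.Gamma α * mlResolvent α lam t =
      t ^ (α - 1) - lam * ∫ s in (0 : ℝ)..t, (t - s) ^ (α - 1) * mlResolvent α lam s := by
  have hΓ := (Real.Gamma_pos_of_pos hα).ne'
  have hpow : t ^ (α + α - 1) = t ^ (α - 1) * t ^ α := by
    rw [← Real.rpow_add ht]
    ring_nf
  rw [integral_sub_rpow_mul_mlResolvent hα hα ht, mlResolvent, mlE_eq_add_mul hα, hpow]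
  field_simp
  ring

theorem sub_rpow_le_mul_sub_rpow {α s t t₀ : ℝ} (hα1 : α ≤ 1) (hs : 0 ≤ s) (hst : s < t)
    (ht : t ≤ t₀) :
    (t₀ - s) ^ (α - 1) ≤ (t₀ / t) ^ (α - 1) * (t - s) ^ (α - 1) := by
  have htpos : 0 < t := hs.trans_lt hst
  have hratio : 0 < t₀ / t := div_pos (htpos.trans_le ht) htpos
  rw [← Real.mul_rpow hratio.le (sub_pos.2 hst).le]
  refine Real.rpow_le_rpow_of_nonpos (mul_pos hratio (sub_pos.2 hst)) ?_ (by linarith)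
  rw [div_mul_eq_mul_div, div_le_iff₀ htpos]
  nlinarith

/-- The resolvent of a kernel `λ t ^ (α - 1) / Γ(α)` cannot lose positivity. -/
theorem mlResolvent_pos_of_forall_lt {α lam t₀ : ℝ} (hα : 0 < α) (hα1 : α ≤ 1) (hlam : 0 ≤ lam)
    (ht₀ : 0 < t₀) (hpos : ∀ s ∈ Ioo 0 t₀, 0 < mlResolvent α lam s) :
    0 < mlResolvent α lam t₀ := by
  by_contra! hneg
  obtain ⟨δ, hδ, hδt, hδsmall⟩ : ∃ δ, 0 < δ ∧ δ ≤ t₀ / 2 ∧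
      lam * (δ ^ α / α) < Real.Gamma α * (1 / 2) := by
    have hlim : Tendsto (fun δ : ℝ => lam * (δ ^ α / α)) (𝓝[>] 0) (𝓝 0) := by
      have hc : Continuous fun δ : ℝ => lam * (δ ^ α / α) :=
        continuous_const.mul ((Real.continuous_rpow_const hα.le).div_const _)
      simpa [Real.zero_rpow hα.ne'] using (hc.tendsto 0).mono_left nhdsWithin_le_nhds
    have hΓ : 0 < Real.Gamma α * (1 / 2) := by
      have := Real.Gamma_pos_of_pos hα
      positivity
    have hsmall : ∀ᶠ δ in 𝓝[>] (0 : ℝ), δ ≤ t₀ / 2 :=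
      nhdsWithin_le_nhds (Iic_mem_nhds (by positivity))
    obtain ⟨δ, hδ⟩ := ((hlim.eventually_lt_const hΓ).and
      (hsmall.and self_mem_nhdsWithin)).exists
    exact ⟨δ, hδ.2.2, hδ.2.1, hδ.1⟩
  obtain ⟨t, ht, hmax⟩ := isCompact_Icc.exists_isMaxOn
    (nonempty_Icc.2 (by linarith : t₀ - δ ≤ t₀))
    ((continuousOn_mlResolvent (lam := lam) hα).mono fun x hx =>
      (by linarith [hx.1] : (0 : ℝ) < x))
  have hmax' : ∀ s ∈ Icc (t₀ - δ) t₀, mlResolvent α lam s ≤ mlResolvent α lam t := hmax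
  have htval : 0 < mlResolvent α lam t :=
    (hpos _ ⟨by linarith, by linarith⟩).trans_le (hmax' (t₀ - δ) ⟨le_rfl, by linarith⟩)
  have htt₀ : t < t₀ := by
    refine lt_of_le_of_ne ht.2 ?_
    rintro rfl
    linarith
  have htpos : 0 < t := by linarith [ht.1]
  have hint₀ := intervalIntegrable_sub_rpow_mul_mlResolvent (lam := lam) hα hα ht₀
  have hint := intervalIntegrable_sub_rpow_mul_mlResolvent (lam := lam) hα hα htpos
  have hint₁ : IntervalIntegrable (fun s => (t₀ - s) ^ (α - 1) * mlResolvent α lam s)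
      volume 0 t := hint₀.mono_set (by
    rw [uIcc_of_le htpos.le, uIcc_of_le ht₀.le]; exact Icc_subset_Icc_right ht.2)
  have hint₂ : IntervalIntegrable (fun s => (t₀ - s) ^ (α - 1) * mlResolvent α lam s)
      volume t t₀ := hint₀.mono_set (by
    rw [uIcc_of_le ht.2, uIcc_of_le ht₀.le]; exact Icc_subset_Icc_left htpos.le)
  have hker : IntervalIntegrable (fun s => (t₀ - s) ^ (α - 1)) volume t t₀ := by
    have := (intervalIntegral.intervalIntegrable_rpow' (a := t₀ - t) (b := t₀ - t₀)
      (by linarith : -1 < α - 1)).comp_sub_left t₀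
    simpa using this
  set ρ : ℝ := (t₀ / t) ^ (α - 1) with hρ
  have hfirst : ∫ s in (0 : ℝ)..t, (t₀ - s) ^ (α - 1) * mlResolvent α lam s ≤
      ρ * ∫ s in (0 : ℝ)..t, (t - s) ^ (α - 1) * mlResolvent α lam s := by
    rw [← intervalIntegral.integral_const_mul]
    refine intervalIntegral.integral_mono_on_of_le_Ioo htpos.le hint₁ (hint.const_mul _)
      fun s hs => ?_
    rw [← mul_assoc]
    exact mul_le_mul_of_nonneg_right (sub_rpow_le_mul_sub_rpow hα1 hs.1.le hs.2 ht.2)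
      (hpos s ⟨hs.1, hs.2.trans htt₀⟩).le
  have hsecond : ∫ s in t..t₀, (t₀ - s) ^ (α - 1) * mlResolvent α lam s ≤
      δ ^ α / α * mlResolvent α lam t := by
    calc ∫ s in t..t₀, (t₀ - s) ^ (α - 1) * mlResolvent α lam s
        ≤ ∫ s in t..t₀, (t₀ - s) ^ (α - 1) * mlResolvent α lam t := by
          refine intervalIntegral.integral_mono_on ht.2 hint₂ (hker.mul_const _) fun s hs => ?_
          exact mul_le_mul_of_nonneg_left (hmax' s ⟨ht.1.trans hs.1, hs.2⟩)
            (Real.rpow_nonneg (sub_nonneg.2 hs.2) _)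
      _ = (t₀ - t) ^ α / α * mlResolvent α lam t := by
          rw [intervalIntegral.integral_mul_const,
            intervalIntegral.integral_comp_sub_left (fun x => x ^ (α - 1)), sub_self,
            integral_rpow (Or.inl (by linarith))]
          simp [Real.zero_rpow hα.ne']
      _ ≤ δ ^ α / α * mlResolvent α lam t := by
          have h0 : 0 ≤ t₀ - t := by linarith
          gcongr
          linarith [ht.1]
  have hρpow : ρ * t ^ (α - 1) = t₀ ^ (α - 1) := by
    rw [hρ, ← Real.mul_rpow (by positivity) htpos.le, div_mul_cancel₀ _ htpos.ne']
  have hρge : 1 / 2 ≤ ρ := by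
    have hle2 : t₀ / t ≤ 2 := by
      rw [div_le_iff₀ htpos]
      linarith [ht.1]
    calc (1 / 2 : ℝ) = 2 ^ (-1 : ℝ) := by rw [Real.rpow_neg_one]; norm_num
      _ ≤ 2 ^ (α - 1) := Real.rpow_le_rpow_of_exponent_le (by norm_num) (by linarith)
      _ ≤ ρ := Real.rpow_le_rpow_of_nonpos (by positivity) hle2 (by linarith)
  have hV₀ := Gamma_mul_mlResolvent (lam := lam) hα ht₀
  have hV := Gamma_mul_mlResolvent (lam := lam) hα htpos
  rw [← intervalIntegral.integral_add_adjacent_intervals hint₁ hint₂] at hV₀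
  have hΓ := Real.Gamma_pos_of_pos hα
  have h1 := mul_le_mul_of_nonneg_left hfirst hlam
  have h2 := mul_le_mul_of_nonneg_left hsecond hlam
  have h3 : Real.Gamma α * (ρ * mlResolvent α lam t) -
      lam * (δ ^ α / α) * mlResolvent α lam t ≤ Real.Gamma α * mlResolvent α lam t₀ := by
    have : Real.Gamma α * (ρ * mlResolvent α lam t) = t₀ ^ (α - 1) -
        lam * (ρ * ∫ s in (0 : ℝ)..t, (t - s) ^ (α - 1) * mlResolvent α lam s) := by
      rw [← hρpow]
      linear_combination ρ * hV
    rw [this, hV₀]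
    linarith
  have h4 : Real.Gamma α * mlResolvent α lam t₀ ≤ 0 := mul_nonpos_of_nonneg_of_nonpos hΓ.le hneg
  have h5 := mul_lt_mul_of_pos_right hδsmall htval
  have h6 : Real.Gamma α * (1 / 2 * mlResolvent α lam t) ≤
      Real.Gamma α * (ρ * mlResolvent α lam t) := by gcongr
  linarith

theorem mlResolvent_pos {α lam t : ℝ} (hα : 0 < α) (hα1 : α ≤ 1) (hlam : 0 ≤ lam) (ht : 0 < t) :
    0 < mlResolvent α lam t := by
  set h : ℝ → ℝ := fun s => mlE α α (-lam * s ^ α)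
  have hcont : Continuous h := (continuous_mlE hα).comp
    (continuous_const.mul (Real.continuous_rpow_const hα.le))
  have hzero : 0 < h 0 := by
    have : h 0 = 1 / Real.Gamma α := by
      simp only [h, Real.zero_rpow hα.ne', mul_zero]
      rw [mlE_eq_add_mul hα, zero_mul, add_zero]
    rw [this]
    exact one_div_pos.2 (Real.Gamma_pos_of_pos hα)
  have hiff : ∀ s, 0 < s → (0 < mlResolvent α lam s ↔ 0 < h s) := fun s hs =>
    mul_pos_iff_of_pos_left (Real.rpow_pos_of_pos hs _)
  by_contra hnot
  set S : Set ℝ := Ici 0 ∩ {s | h s ≤ 0}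
  have hS : IsClosed S := isClosed_Ici.inter (isClosed_le hcont continuous_const)
  have hbdd : BddBelow S := ⟨0, fun s hs => hs.1⟩
  have hmem : sInf S ∈ S :=
    hS.csInf_mem ⟨t, ht.le, not_lt.1 fun hh => hnot ((hiff t ht).2 hh)⟩ hbdd
  have hne : 0 < sInf S := by
    refine lt_of_le_of_ne hmem.1 fun h0 => ?_
    have := hmem.2
    rw [← h0] at this
    exact absurd hzero (not_lt.2 this)
  have hpos := mlResolvent_pos_of_forall_lt hα hα1 hlam hne fun s hs =>
    (hiff s hs.1).2 (not_le.1 fun hh => absurd hs.2 (not_lt.2 (csInf_le hbdd ⟨hs.1.le, hh⟩)))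
  exact absurd ((hiff _ hne).1 hpos) (not_lt.2 hmem.2)

theorem mlResolvent_le {α lam t : ℝ} (hα : 0 < α) (hα1 : α ≤ 1) (hlam : 0 ≤ lam) (ht : 0 < t) :
    mlResolvent α lam t ≤ t ^ (α - 1) / Real.Gamma α := by
  rw [le_div_iff₀ (Real.Gamma_pos_of_pos hα), mul_comm, Gamma_mul_mlResolvent hα ht,
    sub_le_self_iff]
  refine mul_nonneg hlam ?_
  rw [intervalIntegral.integral_of_le ht.le]
  refine setIntegral_nonneg measurableSet_Ioc fun s hs => ?_
  exact mul_nonneg (Real.rpow_nonneg (sub_nonneg.2 hs.2) _) (mlResolvent_pos hα hα1 hlam hs.1).le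

theorem intervalIntegrable_mlResolvent {α lam t : ℝ} (hα : 0 < α) (ht : 0 ≤ t) :
    IntervalIntegrable (mlResolvent α lam) volume 0 t := by
  rcases ht.eq_or_lt with rfl | ht
  · simp
  · simpa using intervalIntegrable_sub_rpow_mul_mlResolvent (lam := lam) hα one_pos ht

theorem integral_mlResolvent {α lam t : ℝ} (hα : 0 < α) (ht : 0 ≤ t) :
    ∫ s in (0 : ℝ)..t, mlResolvent α lam s = t ^ α * mlE α (α + 1) (-lam * t ^ α) := by
  rcases ht.eq_or_lt with rfl | ht
  · simp [Real.zero_rpow hα.ne']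
  · simpa using integral_sub_rpow_mul_mlResolvent (lam := lam) hα one_pos ht

theorem abs_rpow_mul_mlE_sub_le {α lam a b : ℝ} (hα : 0 < α) (hα1 : α ≤ 1) (hlam : 0 ≤ lam)
    (ha : 0 ≤ a) (hab : a ≤ b) :
    |b ^ α * mlE α (α + 1) (-lam * b ^ α) - a ^ α * mlE α (α + 1) (-lam * a ^ α)| ≤
      (b ^ α - a ^ α) / (α * Real.Gamma α) := by
  have hb : 0 ≤ b := ha.trans hab
  have hinta := intervalIntegrable_mlResolvent (lam := lam) hα ha
  have hintb := intervalIntegrable_mlResolvent (lam := lam) hα hb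
  rw [← integral_mlResolvent hα hb, ← integral_mlResolvent hα ha,
    intervalIntegral.integral_interval_sub_left hintb hinta, abs_of_nonneg]
  · calc ∫ s in a..b, mlResolvent α lam s ≤ ∫ s in a..b, s ^ (α - 1) / Real.Gamma α := by
          refine intervalIntegral.integral_mono_on_of_le_Ioo hab (hinta.symm.trans hintb)
            ((intervalIntegral.intervalIntegrable_rpow' (by linarith)).div_const _) fun s hs => ?_
          exact mlResolvent_le hα hα1 hlam (ha.trans_lt hs.1)
      _ = (b ^ α - a ^ α) / (α * Real.Gamma α) := by
          rw [intervalIntegral.integral_div, integral_rpow (Or.inl (by linarith)), sub_add_cancel,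
            div_div]
  · rw [intervalIntegral.integral_of_le hab]
    exact setIntegral_nonneg measurableSet_Ioc fun s hs =>
      (mlResolvent_pos hα hα1 hlam (ha.trans_lt hs.1)).le

theorem rpow_sub_sub_one_rpow_le {α m : ℝ} (hα : 0 < α) (hα1 : α ≤ 1) (hm : 1 ≤ m) :
    m ^ α - (m - 1) ^ α ≤ m ^ (α - 1) := by
  rcases hm.eq_or_lt with rfl | hm
  · simp [Real.zero_rpow hα.ne']
  · have hm1 : 0 < m - 1 := sub_pos.2 hm
    have hle : m ^ (α - 1) ≤ (m - 1) ^ (α - 1) :=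
      Real.rpow_le_rpow_of_nonpos hm1 (by linarith) (by linarith)
    have h1 : m ^ α = m ^ (α - 1) * m := by
      rw [← Real.rpow_add_one (by linarith), sub_add_cancel]
    have h2 : (m - 1) ^ α = (m - 1) ^ (α - 1) * (m - 1) := by
      rw [← Real.rpow_add_one hm1.ne', sub_add_cancel]
    rw [h1, h2]
    nlinarith

/-- Weight estimate for the exponential integrator: there is `C′ > 0`,
depending only on `α`, such that `|W_{n,j}| ≤ C′ τ^α (n−j)^{α−1}` for all
`λ ≥ 0`, `τ > 0`, `n ≥ 1` and `1 ≤ j ≤ n−1`. -/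
theorem eiWeight_estimate (α : ℝ) (hα : 0 < α) (hα1 : α < 1) :
    ∃ C' : ℝ, 0 < C' ∧ ∀ lam : ℝ, 0 ≤ lam → ∀ τ : ℝ, 0 < τ →
      ∀ n j : ℕ, 1 ≤ n → 1 ≤ j → j + 1 ≤ n →
        |eiWeight α lam τ n j| ≤ C' * τ ^ α * ((n : ℝ) - j) ^ (α - 1) := by
  have hΓ := Real.Gamma_pos_of_pos hα
  refine ⟨1 / (α * Real.Gamma α), by positivity, fun lam hlam τ hτ n j _ _ hjn => ?_⟩
  have hm : 1 ≤ (n : ℝ) - j := by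
    have : (j : ℝ) + 1 ≤ n := by exact_mod_cast hjn
    linarith
  have hb : (n : ℝ) * τ - j * τ = τ * ((n : ℝ) - j) := by ring
  have ha : (n : ℝ) * τ - (j + 1) * τ = τ * ((n : ℝ) - j - 1) := by ring
  have hm0 : 0 ≤ (n : ℝ) - j - 1 := by linarith
  rw [eiWeight, ha, hb]
  refine (abs_rpow_mul_mlE_sub_le hα hα1.le hlam (by positivity)
    (mul_le_mul_of_nonneg_left (by linarith) hτ.le)).trans ?_
  rw [Real.mul_rpow hτ.le (by linarith), Real.mul_rpow hτ.le hm0, ← mul_sub, mul_assoc,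
    one_div_mul_eq_div]
  gcongr
  exact rpow_sub_sub_one_rpow_le hα hα1.le hm
end

section
/- Let 0 < α < 1 and λ ∈ ℝ. The function u(t) = E_α(−λ t^α) satisfies u(0) = 1 and (D^α u)(t) = −λ u(t) for all t > 0, where D^α is the Caputo fractional derivative of order α. -/
open MeasureTheory

/-- The Caputo fractional derivative of order `α`. -/
noncomputable def caputo (α : ℝ) (u : ℝ → ℝ) (t : ℝ) : ℝ :=
  (1 / Real.Gamma (1 - α)) * ∫ s in (0:ℝ)..t, deriv u s * (t - s) ^ (-α)

theorem Real.rpow_mul_exp_neg_le_Gamma {A s : ℝ} (hA : 0 < A) (hs : 1 ≤ s) :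
    A ^ (s - 1) * Real.exp (-A) ≤ Real.Gamma s := by
  have hs0 : 0 < s := by linarith
  have hint := Real.GammaIntegral_convergent hs0
  have hsub : Set.Ioi A ⊆ Set.Ioi (0 : ℝ) := Set.Ioi_subset_Ioi hA.le
  rw [Real.Gamma_eq_integral hs0, ← integral_exp_neg_Ioi A, ← integral_const_mul]
  calc ∫ x in Set.Ioi A, A ^ (s - 1) * Real.exp (-x)
      ≤ ∫ x in Set.Ioi A, Real.exp (-x) * x ^ (s - 1) := by
        refine setIntegral_mono_on ((integrableOn_exp_neg_Ioi A).const_mul _)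
          (hint.mono_set hsub) measurableSet_Ioi fun x hx => ?_
        rw [mul_comm]
        exact mul_le_mul_of_nonneg_left
          (Real.rpow_le_rpow hA.le (le_of_lt hx) (by linarith)) (Real.exp_pos _).le
    _ ≤ ∫ x in Set.Ioi 0, Real.exp (-x) * x ^ (s - 1) := by
        refine setIntegral_mono_set hint ?_ hsub.eventuallyLE
        filter_upwards [ae_restrict_mem measurableSet_Ioi] with x hx
        exact mul_nonneg (Real.exp_pos _).le (Real.rpow_nonneg (le_of_lt hx) _)

theorem summable_mlE_terms {α : ℝ} (hα : 0 < α) (β x : ℝ) :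
    Summable fun k : ℕ => x ^ k / Real.Gamma (α * k + β) := by
  set A : ℝ := (2 * |x| + 1) ^ α⁻¹ with hAdef
  have hB : 0 < 2 * |x| + 1 := by positivity
  have hA : 0 < A := Real.rpow_pos_of_pos hB _
  have hAα : A ^ α = 2 * |x| + 1 := by
    rw [hAdef, ← Real.rpow_mul hB.le, inv_mul_cancel₀ hα.ne', Real.rpow_one]
  have hr : |x| / (2 * |x| + 1) < 1 := by
    rw [div_lt_one hB]; linarith [abs_nonneg x]
  refine Summable.of_norm_bounded_eventually_nat
    (g := fun k : ℕ => (|x| / (2 * |x| + 1)) ^ k * (A ^ (β - 1) * Real.exp (-A))⁻¹)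
    ((summable_geometric_of_lt_one (by positivity) hr).mul_right _) ?_
  obtain ⟨N, hN⟩ := exists_nat_gt ((1 - β) / α)
  filter_upwards [Filter.eventually_ge_atTop N] with k hk
  have hk1 : 1 ≤ α * k + β := by
    have h1 : (1 - β) / α < k := hN.trans_le (by exact_mod_cast hk)
    rw [div_lt_iff₀ hα] at h1
    linarith
  have hΓ : 0 < Real.Gamma (α * k + β) := Real.Gamma_pos_of_pos (by linarith)
  have hle := Real.rpow_mul_exp_neg_le_Gamma hA hk1
  have hsplit : A ^ (α * k + β - 1) = (2 * |x| + 1) ^ k * A ^ (β - 1) := by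
    rw [add_sub_assoc, Real.rpow_add hA, Real.rpow_mul hA.le, hAα, Real.rpow_natCast]
  rw [hsplit] at hle
  have hA' : 0 < A ^ (β - 1) := Real.rpow_pos_of_pos hA _
  rw [norm_div, norm_pow, Real.norm_eq_abs, Real.norm_of_nonneg hΓ.le, div_pow, div_mul_eq_mul_div,
    ← div_eq_mul_inv, div_div]
  rw [mul_comm (A ^ (β - 1) * _), ← mul_assoc]
  exact div_le_div_of_nonneg_left (by positivity) (by positivity) hle

theorem Real.mul_rpow_pow (c : ℝ) {α s : ℝ} (hs : 0 ≤ s) (k : ℕ) :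
    (c * s ^ α) ^ k = c ^ k * s ^ (α * k) := by
  rw [mul_pow, Real.rpow_mul hs, Real.rpow_natCast]

theorem hasDerivAt_mlE_rpow {α : ℝ} (hα : 0 < α) (c : ℝ) {s : ℝ} (hs : 0 < s) :
    HasDerivAt (fun y : ℝ => mlE α 1 (c * y ^ α))
      (∑' k : ℕ, c ^ k * s ^ (α * k - 1) / Real.Gamma (α * k)) s := by
  have hs2 : s / 2 < s := by linarith
  have hmem : s ∈ Set.Ioo (s / 2) (2 * s) := ⟨hs2, by linarith⟩
  have key : HasDerivAt (fun y : ℝ => ∑' k : ℕ, c ^ k * y ^ (α * k) / Real.Gamma (α * k + 1))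
      (∑' k : ℕ, c ^ k * s ^ (α * k - 1) / Real.Gamma (α * k)) s := by
    refine hasDerivAt_tsum_of_isPreconnected
      (u := fun k : ℕ => (|c| * (2 * s) ^ α) ^ k / Real.Gamma (α * k + 0) * (s / 2)⁻¹)
      ((summable_mlE_terms hα 0 _).mul_right _) isOpen_Ioo isPreconnected_Ioo
      (g := fun (k : ℕ) (y : ℝ) => c ^ k * y ^ (α * k) / Real.Gamma (α * k + 1))
      (g' := fun (k : ℕ) (y : ℝ) => c ^ k * y ^ (α * k - 1) / Real.Gamma (α * k))
      (fun k y hy => ?_) (fun k y hy => ?_) hmem ?_ hmem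
    · have hy0 : 0 < y := by linarith [hy.1]
      have h := ((Real.hasDerivAt_rpow_const (p := α * k) (Or.inl hy0.ne')).const_mul
        (c ^ k)).div_const (Real.Gamma (α * k + 1))
      refine h.congr_deriv ?_
      rcases Nat.eq_zero_or_pos k with rfl | hk
      · simp
      · have hk' : 0 < α * k := by positivity
        have := (Real.Gamma_pos_of_pos hk').ne'
        rw [Real.Gamma_add_one hk'.ne']
        field_simp
    · have hy0 : 0 < y := by linarith [hy.1]
      have hk' : 0 ≤ α * k := by positivity
      have hΓ : 0 ≤ Real.Gamma (α * k) := Real.Gamma_nonneg_of_nonneg hk'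
      rw [add_zero, Real.mul_rpow_pow _ (by positivity), norm_div, norm_mul, norm_pow,
        Real.norm_eq_abs, Real.norm_of_nonneg hΓ, Real.norm_of_nonneg (by positivity),
        Real.rpow_sub_one hy0.ne', div_mul_eq_mul_div, div_eq_mul_inv (y ^ _), ← mul_assoc]
      gcongr
      · exact hy.2.le
      · exact hy.1.le
    · simpa only [Real.mul_rpow_pow c hs.le] using summable_mlE_terms hα 1 (c * s ^ α)
  refine key.congr_of_eventuallyEq ?_
  filter_upwards [lt_mem_nhds hs] with y hy
  simp only [mlE, Real.mul_rpow_pow c hy.le]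

theorem integral_rpow_mul_sub_rpow {a b t : ℝ} (ha : 0 < a) (hb : 0 < b) (ht : 0 < t) :
    ∫ s in (0 : ℝ)..t, s ^ (a - 1) * (t - s) ^ (b - 1)
      = t ^ (a + b - 1) * (Real.Gamma a * Real.Gamma b / Real.Gamma (a + b)) := by
  have h := Complex.betaIntegral_scaled (a : ℂ) (b : ℂ) ht
  rw [Complex.betaIntegral_eq_Gamma_mul_div _ _ (by simpa) (by simpa)] at h
  apply Complex.ofReal_injective
  rw [← intervalIntegral.integral_ofReal]
  push_cast [Complex.ofReal_cpow ht.le, ← Complex.Gamma_ofReal]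
  rw [← h]
  refine intervalIntegral.integral_congr fun s hs => ?_
  rw [Set.uIcc_of_le ht.le] at hs
  rw [Complex.ofReal_cpow hs.1, Complex.ofReal_cpow (sub_nonneg.2 hs.2)]
  push_cast
  rfl

theorem intervalIntegrable_rpow_mul_sub_rpow {a b t : ℝ} (ha : 0 < a) (hb : 0 < b) (ht : 0 < t) :
    IntervalIntegrable (fun s : ℝ => s ^ (a - 1) * (t - s) ^ (b - 1)) volume 0 t := by
  apply intervalIntegral.intervalIntegrable_of_integral_ne_zero
  rw [integral_rpow_mul_sub_rpow ha hb ht]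
  have := Real.Gamma_pos_of_pos ha
  have := Real.Gamma_pos_of_pos hb
  have := Real.Gamma_pos_of_pos (add_pos ha hb)
  positivity

/-- The termwise fractional integral of order `1 - α` of the derivative of `E_α(c t^α)`. -/
theorem hasSum_integral_mlE_deriv_terms {α : ℝ} (hα : 0 < α) (hα1 : α < 1) (c : ℝ) {t : ℝ}
    (ht : 0 < t) :
    HasSum (fun k : ℕ => c * Real.Gamma (1 - α) * ((c * t ^ α) ^ k / Real.Gamma (α * k + 1)))
      (∫ s in (0 : ℝ)..t, ∑' k : ℕ, c ^ (k + 1) / Real.Gamma (α * (k + 1)) *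
        (s ^ (α * (k + 1) - 1) * (t - s) ^ (-α))) := by
  have hb : 0 < 1 - α := by linarith
  have hexp : (-α : ℝ) = 1 - α - 1 := by ring
  have hk (k : ℕ) : 0 < α * (k + 1) := by positivity
  have hint (d : ℝ) (k : ℕ) : ∫ s in (0 : ℝ)..t, d ^ (k + 1) / Real.Gamma (α * (k + 1)) *
        (s ^ (α * (k + 1) - 1) * (t - s) ^ (-α)) =
      d * Real.Gamma (1 - α) * ((d * t ^ α) ^ k / Real.Gamma (α * k + 1)) := by
    have hΓ := (Real.Gamma_pos_of_pos (hk k)).ne'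
    rw [intervalIntegral.integral_const_mul, hexp, integral_rpow_mul_sub_rpow (hk k) hb ht,
      Real.mul_rpow_pow d ht.le, show α * (k + 1) + (1 - α) = α * k + 1 by ring,
      add_sub_cancel_right, pow_succ]
    field_simp
  have hnorm (k : ℕ) : ∫ s in Set.Ioc 0 t, ‖c ^ (k + 1) / Real.Gamma (α * (k + 1)) *
        (s ^ (α * (k + 1) - 1) * (t - s) ^ (-α))‖ =
      |c| * Real.Gamma (1 - α) * ((|c| * t ^ α) ^ k / Real.Gamma (α * k + 1)) := by
    rw [← hint, intervalIntegral.integral_of_le ht.le]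
    refine setIntegral_congr_fun measurableSet_Ioc fun s hs => ?_
    have hΓ := Real.Gamma_pos_of_pos (hk k)
    have h1 : 0 ≤ s ^ (α * (k + 1) - 1) * (t - s) ^ (-α) :=
      mul_nonneg (Real.rpow_nonneg hs.1.le _) (Real.rpow_nonneg (sub_nonneg.2 hs.2) _)
    simp only [norm_mul (_ / _), norm_div, norm_pow, Real.norm_eq_abs, abs_of_nonneg h1,
      abs_of_pos hΓ]
  simp_rw [← hint, intervalIntegral.integral_of_le ht.le]
  refine hasSum_integral_of_summable_integral_norm (fun k => ?_) ?_
  · rw [hexp]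
    exact (((intervalIntegrable_iff_integrableOn_Ioc_of_le ht.le).1
      (intervalIntegrable_rpow_mul_sub_rpow (hk k) hb ht)).const_mul _)
  · simp_rw [hnorm]
    exact (summable_mlE_terms hα 1 _).mul_left _

theorem summable_mlE_deriv_terms {α : ℝ} (hα : 0 < α) (c : ℝ) {s : ℝ} (hs : 0 < s) :
    Summable fun k : ℕ => c ^ k * s ^ (α * k - 1) / Real.Gamma (α * k) := by
  refine ((summable_mlE_terms hα 0 (c * s ^ α)).mul_right s⁻¹).congr fun k => ?_
  rw [Real.mul_rpow_pow c hs.le, Real.rpow_sub_one hs.ne', add_zero]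
  ring

/-- For `0 < α < 1` and `λ ∈ ℝ`, the function `u(t) = E_α(−λ t^α)` satisfies
`u(0) = 1` and `(D^α u)(t) = −λ u(t)` for all `t > 0`. -/
theorem mittagLeffler_caputo_eigenfunction (α lam : ℝ) (hα : 0 < α) (hα1 : α < 1) :
    mlE α 1 (-lam * (0:ℝ) ^ α) = 1 ∧
    ∀ t : ℝ, 0 < t →
      caputo α (fun s : ℝ => mlE α 1 (-lam * s ^ α)) t
        = -lam * mlE α 1 (-lam * t ^ α) := by
  constructor
  · rw [Real.zero_rpow hα.ne', mul_zero, mlE, tsum_eq_single 0 fun k hk => by simp [hk]]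
    simp
  · intro t ht
    have hΓ := (Real.Gamma_pos_of_pos (sub_pos.2 hα1)).ne'
    have hcongr : ∫ s in (0 : ℝ)..t,
          deriv (fun s : ℝ => mlE α 1 (-lam * s ^ α)) s * (t - s) ^ (-α) =
        ∫ s in (0 : ℝ)..t, ∑' k : ℕ, (-lam) ^ (k + 1) / Real.Gamma (α * (k + 1)) *
          (s ^ (α * (k + 1) - 1) * (t - s) ^ (-α)) := by
      rw [intervalIntegral.integral_of_le ht.le, intervalIntegral.integral_of_le ht.le]
      refine setIntegral_congr_fun measurableSet_Ioc fun s hs => ?_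
      rw [(hasDerivAt_mlE_rpow hα (-lam) hs.1).deriv,
        (summable_mlE_deriv_terms hα (-lam) hs.1).tsum_eq_zero_add]
      simp only [Nat.cast_zero, mul_zero, Real.Gamma_zero, div_zero, zero_add, Nat.cast_add,
        Nat.cast_one]
      rw [← tsum_mul_right]
      refine tsum_congr fun k => ?_
      ring
    rw [caputo, hcongr, ← (hasSum_integral_mlE_deriv_terms hα hα1 (-lam) ht).tsum_eq,
      tsum_mul_left, mlE]
    field_simp
end
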